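/- For every n ≥ 2, the set conv{z^σ : σ a permutation of [2n] with σ({2i−1,2i}) = {2i−1,2i} for every i ∈ [n]} is a face of conv(φ_{2n}); it is the intersection of conv(φ_{2n}) with the supporting hyperplanes z_{2i−1,2i,2i−1,2i} = 1, i ∈ [n]. -/

import Mathlib

/-- Ambient space for edge-permutation matrices: rows and columns indexed by
finite subsets of vertices (only 2-element subsets, i.e. edges of `K_n`, carry
nonzero entries). -/
abbrev EdgeSpace (n : ℕ) := Finset (Fin n) → Finset (Fin n) → ℝ

/-- The edge-permutation matrix `z^σ` of a permutation `σ`: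
`z^σ_{e,f} = 1` iff `e` is an edge and `σ(e) = f` (zero outside edge pairs). -/
def zMat {n : ℕ} (σ : Equiv.Perm (Fin n)) : EdgeSpace n :=
  fun e f => if e.card = 2 ∧ e.image σ = f then 1 else 0

/-- `φ_n`, the set of edge-permutation matrices of all permutations of `[n]`. -/
def phi (n : ℕ) : Set (EdgeSpace n) := {z | ∃ σ : Equiv.Perm (Fin n), z = zMat σ}

/-- `F` is a face of `S`: either `S` itself, or the set of maximizers over `S`
of some linear functional. -/
def IsFaceOf {E : Type*} [AddCommGroup E] [Module ℝ E] (F S : Set E) : Prop :=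
  F = S ∨ ∃ φ : E →ₗ[ℝ] ℝ, F = {x ∈ S | ∀ y ∈ S, φ y ≤ φ x}

/-- Vertex `2i-1` (1-based), i.e. `2i` (0-based), of the pair structure on `[2n]`. -/
def od {n : ℕ} (i : Fin n) : Fin (2 * n) := ⟨2 * i.val, by have := i.isLt; omega⟩

/-- Vertex `2i` (1-based), i.e. `2i+1` (0-based), of the pair structure on `[2n]`. -/
def ev {n : ℕ} (i : Fin n) : Fin (2 * n) := ⟨2 * i.val + 1, by have := i.isLt; omega⟩

/-- If the linear functional `f` is bounded by `c` on `V`, then the points of `conv V` at which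
`f` takes the value `c` form the convex hull of the points of `V` at which it does. -/
theorem convexHull_setOf_eq_of_le {E : Type*} [AddCommGroup E] [Module ℝ E] {V : Set E}
    (f : E →ₗ[ℝ] ℝ) {c : ℝ} (hf : ∀ v ∈ V, f v ≤ c) :
    convexHull ℝ {v ∈ V | f v = c} = {x ∈ convexHull ℝ V | f x = c} := by
  apply Set.Subset.antisymm
  · refine convexHull_min (fun v hv => ⟨subset_convexHull ℝ V hv.1, hv.2⟩) ?_
    exact (convex_convexHull ℝ V).inter (convex_hyperplane f.isLinear c)
  · have hconv : Convex ℝ {x | f x ≤ c ∧ (f x = c → x ∈ convexHull ℝ {v ∈ V | f v = c})} := by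
      rintro x ⟨hx, hx'⟩ y ⟨hy, hy'⟩ a b ha hb hab
      have key : f (a • x + b • y) = a * f x + b * f y := by simp
      have hax : a * f x ≤ a * c := mul_le_mul_of_nonneg_left hx ha
      have hby : b * f y ≤ b * c := mul_le_mul_of_nonneg_left hy hb
      have hc : a * c + b * c = c := by rw [← add_mul, hab, one_mul]
      refine ⟨by linarith, fun h => ?_⟩
      rw [key] at h
      rcases ha.eq_or_lt with rfl | ha
      · obtain rfl : b = 1 := by linarith
        simpa using hy' (by linarith)
      rcases hb.eq_or_lt with rfl | hb
      · obtain rfl : a = 1 := by linarith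
        simpa using hx' (by linarith)
      refine convex_convexHull ℝ _ (hx' ?_) (hy' ?_) ha.le hb.le hab
      · exact mul_left_cancel₀ ha.ne' (by linarith)
      · exact mul_left_cancel₀ hb.ne' (by linarith)
    rintro x ⟨hx, hxc⟩
    have hV : V ⊆ {x | f x ≤ c ∧ (f x = c → x ∈ convexHull ℝ {v ∈ V | f v = c})} :=
      fun v hv => ⟨hf v hv, fun h => subset_convexHull ℝ _ ⟨hv, h⟩⟩
    exact (convexHull_min hV hconv hx).2 hxc

theorem card_od_ev {n : ℕ} (i : Fin n) : ({od i, ev i} : Finset (Fin (2 * n))).card = 2 :=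
  Finset.card_pair (by simp [od, ev])

/-- The sum of the entries `z_{2i-1,2i,2i-1,2i}`, as a linear functional. -/
def pairSum (n : ℕ) : EdgeSpace (2 * n) →ₗ[ℝ] ℝ where
  toFun z := ∑ i : Fin n, z {od i, ev i} {od i, ev i}
  map_add' x y := by simp [Finset.sum_add_distrib]
  map_smul' a x := by simp [Finset.mul_sum]

theorem pairSum_apply {n : ℕ} (z : EdgeSpace (2 * n)) :
    pairSum n z = ∑ i : Fin n, z {od i, ev i} {od i, ev i} := rfl

theorem zMat_le_one {n : ℕ} (σ : Equiv.Perm (Fin n)) (e f : Finset (Fin n)) :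
    zMat σ e f ≤ 1 := by
  unfold zMat
  split_ifs <;> norm_num

theorem zMat_eq_one_iff {n : ℕ} (σ : Equiv.Perm (Fin n)) {e : Finset (Fin n)} (he : e.card = 2)
    (f : Finset (Fin n)) : zMat σ e f = 1 ↔ e.image σ = f := by
  simp [zMat, he]

theorem le_one_of_mem_convexHull_phi {n : ℕ} {z : EdgeSpace n} (hz : z ∈ convexHull ℝ (phi n))
    (e f : Finset (Fin n)) : z e f ≤ 1 := by
  have hconv : Convex ℝ {z : EdgeSpace n | z e f ≤ 1} :=
    convex_halfSpace_le (f := fun z : EdgeSpace n => z e f)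
      ⟨fun _ _ => rfl, fun _ _ => rfl⟩ 1
  refine convexHull_min ?_ hconv hz
  rintro _ ⟨σ, rfl⟩
  exact zMat_le_one σ e f

theorem pairSum_le {n : ℕ} {z : EdgeSpace (2 * n)} (hz : z ∈ convexHull ℝ (phi (2 * n))) :
    pairSum n z ≤ n := by
  rw [pairSum_apply]
  exact (Finset.sum_le_sum fun i _ => le_one_of_mem_convexHull_phi hz _ _).trans (by simp)

theorem pairSum_eq_iff {n : ℕ} {z : EdgeSpace (2 * n)} (hz : z ∈ convexHull ℝ (phi (2 * n))) :
    pairSum n z = n ↔ ∀ i : Fin n, z {od i, ev i} {od i, ev i} = 1 := by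
  have h := Finset.sum_eq_sum_iff_of_le (s := Finset.univ)
    (f := fun i : Fin n => z {od i, ev i} {od i, ev i}) (g := fun _ => (1 : ℝ))
    fun i _ => le_one_of_mem_convexHull_phi hz _ _
  simpa [pairSum_apply] using h

/-- The convex hull of the `z^σ` for pair-preserving permutations `σ` of `[2n]` is a
face of `conv φ_{2n}`, namely its intersection with the supporting hyperplanes
`z_{2i-1,2i,2i-1,2i} = 1`, `i ∈ [n]`. -/
theorem pair_preserving_face (n : ℕ) (hn : 2 ≤ n) :
    let S : Set (EdgeSpace (2 * n)) :=
      {z | ∃ σ : Equiv.Perm (Fin (2 * n)),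
        (∀ i : Fin n, Finset.image σ {od i, ev i} = {od i, ev i}) ∧ z = zMat σ}
    IsFaceOf (convexHull ℝ S) (convexHull ℝ (phi (2 * n))) ∧
    convexHull ℝ S =
      {z ∈ convexHull ℝ (phi (2 * n)) |
        ∀ i : Fin n, z {od i, ev i} {od i, ev i} = 1} := by
  intro S
  have hS : S = {z ∈ phi (2 * n) | pairSum n z = n} := by
    ext z
    constructor
    · rintro ⟨σ, hσ, rfl⟩
      have hmem : zMat σ ∈ phi (2 * n) := ⟨σ, rfl⟩
      exact ⟨hmem, (pairSum_eq_iff (subset_convexHull ℝ _ hmem)).2 fun i =>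
        (zMat_eq_one_iff σ (card_od_ev i) _).2 (hσ i)⟩
    · rintro ⟨⟨σ, rfl⟩, h⟩
      rw [pairSum_eq_iff (subset_convexHull ℝ _ ⟨σ, rfl⟩)] at h
      exact ⟨σ, fun i => (zMat_eq_one_iff σ (card_od_ev i) _).1 (h i), rfl⟩
  have hface : convexHull ℝ S = {z ∈ convexHull ℝ (phi (2 * n)) | pairSum n z = n} := by
    rw [hS]
    exact convexHull_setOf_eq_of_le _ fun v hv => pairSum_le (subset_convexHull ℝ _ hv)
  have hone : zMat 1 ∈ convexHull ℝ (phi (2 * n)) := subset_convexHull ℝ _ ⟨1, rfl⟩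
  have hone_sum : pairSum n (zMat 1) = n :=
    (pairSum_eq_iff hone).2 fun i => (zMat_eq_one_iff 1 (card_od_ev i) _).2 (by simp)
  refine ⟨Or.inr ⟨pairSum n, ?_⟩, ?_⟩
  · rw [hface]
    ext z
    refine and_congr_right fun hz => ⟨fun h y hy => h ▸ pairSum_le hy, fun h => ?_⟩
    exact (pairSum_le hz).antisymm (hone_sum ▸ h _ hone)
  · rw [hface]
    ext z
    exact and_congr_right fun hz => pairSum_eq_iff hz
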